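/- arXiv:1703.03390 — 6 statements merged into one kernel-verified Lean document; each statement's English description precedes it below -/
import Mathlib

section
/- Let L be a finite-dimensional semisimple Lie algebra over ℂ and let x ∈ L have abstract Jordan decomposition x = s + n. Then there exists an element h ∈ L such that [h, s] = 0 and [h, n] = 2·n. -/
theorem Module.End.IsSemisimple.codisjoint_ker_range {R M : Type*} [CommRing R] [AddCommGroup M]
    [Module R M] [IsArtinian R M] {f : Module.End R M} (hf : f.IsSemisimple) :
    Codisjoint (LinearMap.ker f) (LinearMap.range f) := by
  obtain ⟨W, hW, hc⟩ := Module.End.isSemisimple_iff.mp hf (LinearMap.ker f) fun x hx => by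
    simp_all
  refine hc.codisjoint.mono_right fun w hw => ?_
  have hinj : Function.Injective (f.restrict hW) := by
    rw [← LinearMap.ker_eq_bot, LinearMap.ker_eq_bot']
    rintro ⟨y, hy⟩ h
    exact Subtype.ext (Submodule.disjoint_def.mp hc.disjoint y (congrArg Subtype.val h) hy)
  obtain ⟨y, hy⟩ := IsArtinian.surjective_of_injective_endomorphism _ hinj ⟨w, hw⟩
  exact ⟨y, congrArg Subtype.val hy⟩

namespace LieAlgebra

variable {K L : Type*} [Field K] [LieRing L] [LieAlgebra K L]

theorem killingForm_eq_zero_of_isNilpotent_ad_of_lie_eq_zero {n z : L}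
    (hn : IsNilpotent (ad K L n)) (hz : ⁅n, z⁆ = 0) : killingForm K L n z = 0 := by
  rw [killingForm_apply_apply]
  have hcomm : Commute (ad K L n) (ad K L z) :=
    LinearMap.ext fun y => by simp [leibniz_lie n z y, hz]
  exact (LinearMap.isNilpotent_trace_of_isNilpotent (hcomm.isNilpotent_mul_right hn)).eq_zero

/-- A nilpotent element `n` commuting with a semisimple element `s` of a Lie algebra with
non-degenerate Killing form lies in the image of the centralizer of `s` under `ad n`. -/
theorem IsKilling.exists_lie_eq_of_isNilpotent_ad [FiniteDimensional K L] [IsKilling K L]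
    {s n : L} (hs : (ad K L s).IsSemisimple) (hn : IsNilpotent (ad K L n)) (hsn : ⁅s, n⁆ = 0) :
    ∃ c : L, ⁅s, c⁆ = 0 ∧ ⁅n, c⁆ = n := by
  have decomp (y : L) : ∃ a u : L, ⁅s, a⁆ = 0 ∧ a + ⁅s, u⁆ = y := by
    have hy : y ∈ LinearMap.ker (ad K L s) ⊔ LinearMap.range (ad K L s) :=
      hs.codisjoint_ker_range.eq_top ▸ Submodule.mem_top
    obtain ⟨a, ha, _, ⟨u, rfl⟩, h⟩ := Submodule.mem_sup.mp hy
    exact ⟨a, u, ha, h⟩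
  have orth {a : L} (ha : ⁅s, a⁆ = 0) (u : L) : killingForm K L a ⁅s, u⁆ = 0 := by
    rw [← LieModule.traceForm_apply_lie_apply, ← lie_skew, ha]
    simp
  suffices h : n ∈ (LinearMap.ker (ad K L s)).map (ad K L n) by
    obtain ⟨c, hc, hcn⟩ := h
    exact ⟨c, hc, hcn⟩
  have hrefl := (LieModule.traceForm_isSymm K L L).isRefl
  rw [← LinearMap.BilinForm.orthogonal_orthogonal (IsKilling.killingForm_nondegenerate K L) hrefl
    ((LinearMap.ker (ad K L s)).map (ad K L n))]
  intro w hw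
  refine hrefl n w ?_
  obtain ⟨a, u, ha, rfl⟩ := decomp w
  have hsan : ⁅s, ⁅a, n⁆⁆ = 0 := by rw [leibniz_lie, ha, hsn]; simp
  have hun : ⁅⁅s, u⁆, n⁆ = ⁅s, ⁅u, n⁆⁆ := by rw [leibniz_lie s u n, hsn]; simp
  have han : ⁅a, n⁆ = 0 := by
    refine (IsKilling.killingForm_nondegenerate K L).1 _ fun y => ?_
    obtain ⟨c, v, hc, rfl⟩ := decomp y
    have hw' := hrefl _ _ (hw ⁅n, c⁆ ⟨c, hc, rfl⟩)
    rw [← LieModule.traceForm_apply_lie_apply, add_lie, hun, map_add, LinearMap.add_apply,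
      LieModule.traceForm_comm K L L ⁅s, _⁆, orth hc, add_zero] at hw'
    rw [map_add, orth hsan, add_zero, hw']
  rw [map_add, orth hsn, add_zero]
  exact killingForm_eq_zero_of_isNilpotent_ad_of_lie_eq_zero hn (by rw [← lie_skew, han, neg_zero])

end LieAlgebra


/-- Let `L` be a finite-dimensional semisimple Lie algebra over `ℂ` and let
`x ∈ L` have abstract Jordan decomposition `x = s + n` (so `ad s` is a semisimple endomorphism,
`ad n` is a nilpotent endomorphism, and `⁅s, n⁆ = 0`).  Then there exists `h ∈ L` with
`⁅h, s⁆ = 0` and `⁅h, n⁆ = 2 • n`. -/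
theorem exists_sl2_scaling_element
    (L : Type*) [LieRing L] [LieAlgebra ℂ L] [FiniteDimensional ℂ L]
    [LieAlgebra.IsSemisimple ℂ L]
    (x s n : L) (hx : x = s + n)
    (hs : (LieAlgebra.ad ℂ L s).IsSemisimple)
    (hn : IsNilpotent (LieAlgebra.ad ℂ L n))
    (hsn : ⁅s, n⁆ = 0) :
    ∃ h : L, ⁅h, s⁆ = 0 ∧ ⁅h, n⁆ = (2 : ℂ) • n := by
  obtain ⟨c, hsc, hnc⟩ := LieAlgebra.IsKilling.exists_lie_eq_of_isNilpotent_ad hs hn hsn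
  refine ⟨(-2 : ℂ) • c, ?_, ?_⟩
  · rw [smul_lie, ← lie_skew, hsc, neg_zero, smul_zero]
  · rw [smul_lie, ← lie_skew, hnc, smul_neg, neg_smul, neg_neg]
end

section
/- Let A ∈ Mat_n(ℂ) and let A = S + N be its Jordan–Chevalley decomposition (S diagonalizable, N nilpotent, S·N = N·S). Then S lies in the closure of the GL_n(ℂ)-conjugacy class of A in Mat_n(ℂ). -/
/-- The `GL_n(ℂ)`-conjugacy class of a matrix `A`: `{g A g⁻¹ : g ∈ GL_n(ℂ)}`. -/
def conjClass {n : ℕ} (A : Matrix (Fin n) (Fin n) ℂ) : Set (Matrix (Fin n) (Fin n) ℂ) :=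
  {B | ∃ g : (Matrix (Fin n) (Fin n) ℂ)ˣ,
    B = (g : Matrix (Fin n) (Fin n) ℂ) * A * ((g⁻¹ : (Matrix (Fin n) (Fin n) ℂ)ˣ) : Matrix (Fin n) (Fin n) ℂ)}

/-- A matrix is diagonalizable if it is `GL_n(ℂ)`-conjugate to a diagonal matrix. -/
def IsDiagonalizable {n : ℕ} (A : Matrix (Fin n) (Fin n) ℂ) : Prop :=
  ∃ g : (Matrix (Fin n) (Fin n) ℂ)ˣ,
    (((g⁻¹ : (Matrix (Fin n) (Fin n) ℂ)ˣ) : Matrix (Fin n) (Fin n) ℂ) * A *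
      (g : Matrix (Fin n) (Fin n) ℂ)).IsDiag

/-- A nilpotent element of a C⋆-algebra is similar to a contraction, via a unit that commutes with
everything commuting with the element and its adjoint. -/
theorem IsNilpotent.exists_norm_units_conj_le_one {A : Type*} [CStarAlgebra A] [PartialOrder A]
    [StarOrderedRing A] {a : A} (ha : IsNilpotent a) :
    ∃ g : Aˣ, ‖(g : A) * a * ((g⁻¹ : Aˣ) : A)‖ ≤ 1 ∧
      ∀ s : A, Commute s a → Commute s (star a) → Commute s g := by
  obtain ⟨m, hm⟩ := ha
  let Q : A := ∑ k ∈ Finset.range m, star (a ^ k) * a ^ k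
  let P : A := 1 + star a * Q * a
  have hQ : Q = P := by
    have h : ∑ k ∈ Finset.range (m + 1), star (a ^ k) * a ^ k = Q := by
      rw [Finset.sum_range_succ, hm, mul_zero, add_zero]
    rw [← h, Finset.sum_range_succ']
    simp only [P, Q, Finset.mul_sum, Finset.sum_mul]
    rw [add_comm]
    congr 1
    · simp
    · refine Finset.sum_congr rfl fun k _ => ?_
      rw [_root_.pow_succ, star_mul]
      simp only [mul_assoc]
  have hQ0 : 0 ≤ Q := Finset.sum_nonneg fun k _ => star_mul_self_nonneg _
  have hP0 : 0 ≤ P := hQ ▸ hQ0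
  have hP : IsStrictlyPositive P :=
    isStrictlyPositive_one.add_nonneg (star_left_conjugate_nonneg hQ0 a)
  obtain ⟨g, hg⟩ := hP.isUnit_cfcSqrt
  have hgg : (g : A) * g = P := by rw [hg]; exact CFC.sqrt_mul_sqrt_self P
  have hgs : star (g : A) = g := by
    rw [hg]; exact (IsSelfAdjoint.of_nonneg (CFC.sqrt_nonneg P)).star_eq
  have hgs' : star ((g⁻¹ : Aˣ) : A) = ((g⁻¹ : Aˣ) : A) := by
    have h : star g = g := Units.ext hgs
    rw [← Units.coe_star, star_inv, h]
  refine ⟨g, ?_, fun s hs hs' => ?_⟩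
  · have hle : star ((g : A) * a * ((g⁻¹ : Aˣ) : A)) * ((g : A) * a * ((g⁻¹ : Aˣ) : A)) ≤ 1 := by
      calc _ = star ((g⁻¹ : Aˣ) : A) * (star a * Q * a) * ((g⁻¹ : Aˣ) : A) := by
            rw [hQ, ← hgg]
            simp only [star_mul, hgs, mul_assoc]
        _ ≤ star ((g⁻¹ : Aˣ) : A) * P * ((g⁻¹ : Aˣ) : A) :=
            star_left_conjugate_le_conjugate (le_add_of_nonneg_left zero_le_one) _
        _ = 1 := by rw [hgs', ← hgg]; simp
    have h1 := (CStarAlgebra.norm_le_one_iff_of_nonneg _ (star_mul_self_nonneg _)).2 hle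
    rw [CStarRing.norm_star_mul_self] at h1
    nlinarith [norm_nonneg ((g : A) * a * ((g⁻¹ : Aˣ) : A))]
  · have hsP : Commute P s := by
      rw [← hQ]
      refine Commute.symm (Commute.sum_right _ _ _ fun k _ => ?_)
      rw [star_pow]
      exact (hs'.pow_right k).mul_right (hs.pow_right k)
    rw [hg]
    exact (hsP.cfcₙ_nnreal NNReal.sqrt).symm

/-- If `s` commutes with a nilpotent `a` and with its adjoint, then `s` is a limit of conjugates
of `s + a`. -/
theorem mem_closure_units_conj_add_of_isNilpotent {A : Type*} [CStarAlgebra A] [PartialOrder A]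
    [StarOrderedRing A] {s a : A} (ha : IsNilpotent a) (hs : Commute s a)
    (hs' : Commute s (star a)) :
    s ∈ closure {b | ∃ g : Aˣ, b = (g : A) * (s + a) * ((g⁻¹ : Aˣ) : A)} := by
  rw [Metric.mem_closure_iff]
  intro ε hε
  have hε2 : ((ε / 2 : ℝ) : ℂ) ≠ 0 := by exact_mod_cast (half_pos hε).ne'
  let r : ℂ := ((ε / 2 : ℝ) : ℂ)⁻¹
  obtain ⟨g, hg, hgc⟩ := (ha.smul r).exists_norm_units_conj_le_one
  have hsg : Commute s g := hgc s (hs.smul_right r) (by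
    rw [star_smul]; exact hs'.smul_right _)
  refine ⟨_, ⟨g, rfl⟩, ?_⟩
  have hconj : (g : A) * (s + a) * ((g⁻¹ : Aˣ) : A) = s + (g : A) * a * ((g⁻¹ : Aˣ) : A) := by
    rw [mul_add, add_mul, ← hsg.eq]
    simp [mul_assoc]
  rw [hconj, dist_self_add_right]
  have : (g : A) * a * ((g⁻¹ : Aˣ) : A) =
      ((ε / 2 : ℝ) : ℂ) • ((g : A) * (r • a) * ((g⁻¹ : Aˣ) : A)) := by
    rw [mul_smul_comm, smul_mul_assoc, smul_smul, mul_inv_cancel₀ hε2, one_smul]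
  rw [this, norm_smul, Complex.norm_real, Real.norm_of_nonneg (half_pos hε).le]
  nlinarith

open scoped Matrix.Norms.L2Operator MatrixOrder in
/-- The case of a diagonal semisimple part. -/
theorem Matrix.IsDiag.mem_closure_conjClass_add {n : ℕ} {D N : Matrix (Fin n) (Fin n) ℂ}
    (hD : D.IsDiag) (hN : IsNilpotent N) (hcomm : Commute D N) :
    D ∈ closure (conjClass (D + N)) := by
  have hnormal : IsStarNormal D := by
    rw [← hD.diagonal_diag]
    refine ⟨?_⟩
    rw [Matrix.star_eq_conjTranspose, Matrix.diagonal_conjTranspose]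
    exact Matrix.commute_diagonal _ _
  refine mem_closure_units_conj_add_of_isNilpotent hN hcomm ?_
  simpa using (hnormal.commute_star_left hcomm).star_star

/-- Let `A = S + N` be the Jordan–Chevalley decomposition of `A ∈ Mat_n(ℂ)`.
Then `S` lies in the closure of the `GL_n(ℂ)`-conjugacy class of `A` in `Mat_n(ℂ)`. -/
theorem semisimple_part_mem_closure_conjClass
    {n : ℕ} (A S N : Matrix (Fin n) (Fin n) ℂ)
    (hA : A = S + N) (hS : IsDiagonalizable S) (hN : IsNilpotent N)
    (hcomm : S * N = N * S) :
    S ∈ closure (conjClass A) := by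
  obtain ⟨g, hD⟩ := hS
  let φ : Matrix (Fin n) (Fin n) ℂ → Matrix (Fin n) (Fin n) ℂ := fun X => g⁻¹.val * X * g.val
  let ψ : Matrix (Fin n) (Fin n) ℂ → Matrix (Fin n) (Fin n) ℂ := fun X => g.val * X * g⁻¹.val
  have hmul (X Y : Matrix (Fin n) (Fin n) ℂ) : φ X * φ Y = φ (X * Y) := by simp [φ, mul_assoc]
  have hNil : IsNilpotent (φ N) := by
    obtain ⟨m, hm⟩ := hN
    exact ⟨m, by rw [Units.conj_pow', hm, mul_zero, zero_mul]⟩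
  have hc : Commute (φ S) (φ N) := by
    rw [commute_iff_eq, hmul, hmul, hcomm]
  have hψφ (X : Matrix (Fin n) (Fin n) ℂ) : ψ (φ X) = X := by simp [φ, ψ, mul_assoc]
  have hmaps : Set.MapsTo ψ (conjClass (φ S + φ N)) (conjClass A) := by
    rintro _ ⟨h, rfl⟩
    refine ⟨g * h * g⁻¹, ?_⟩
    simp [hA, φ, ψ, mul_assoc, mul_add, add_mul]
  have hψ : Continuous ψ := by fun_prop
  have := map_mem_closure hψ (hD.mem_closure_conjClass_add hNil hc) hmaps
  rwa [hψφ] at this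
end

section
/- For A ∈ Mat_n(ℂ), the GL_n(ℂ)-conjugacy class of A is a closed subset of Mat_n(ℂ) if and only if A is diagonalizable. -/
open Module Polynomial

section Combinatorics

/-- Two finite families with the same multiset of values differ by a permutation of the indices. -/
theorem exists_perm_comp_eq_of_map_univ_eq {ι α : Type*} [Fintype ι] {f g : ι → α}
    (h : Finset.univ.val.map f = Finset.univ.val.map g) : ∃ σ : Equiv.Perm ι, f ∘ σ = g := by
  classical
  have hcard (c : α) : Fintype.card {a // g a = c} = Fintype.card {a // f a = c} := by
    have h' := congrArg (Multiset.count c) h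
    simp only [Multiset.count_map, eq_comm (a := c)] at h'
    rw [Fintype.card_subtype, Fintype.card_subtype]
    exact h'.symm
  exact ⟨Equiv.ofFiberEquiv fun c ↦ Fintype.equivOfCardEq (hcard c),
    funext fun a ↦ Equiv.ofFiberEquiv_map _ a⟩

end Combinatorics

section Topology

theorem Matrix.continuous_aeval {m R : Type*} [Fintype m] [DecidableEq m] [CommRing R]
    [TopologicalSpace R] [IsTopologicalRing R] (p : R[X]) :
    Continuous fun A : Matrix m m R ↦ aeval A p := by
  simp only [aeval_eq_sum_range]
  fun_prop

theorem Matrix.isClosed_setOf_charpoly_eq {m R : Type*} [Fintype m] [DecidableEq m] [CommRing R]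
    [IsDomain R] [Infinite R] [TopologicalSpace R] [IsTopologicalRing R] [T1Space R] (p : R[X]) :
    IsClosed {A : Matrix m m R | A.charpoly = p} := by
  have : {A : Matrix m m R | A.charpoly = p} =
      ⋂ t : R, {A | (Matrix.scalar m t - A).det = p.eval t} := by
    ext A
    simp only [Set.mem_ofPred_eq, Set.mem_iInter, ← Matrix.eval_charpoly]
    exact ⟨fun h t ↦ by rw [h], Polynomial.funext⟩
  rw [this]
  refine isClosed_iInter fun t ↦ isClosed_singleton.preimage (f := fun A : Matrix m m R ↦ _) ?_
  fun_prop

end Topology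

section Eigenspaces

/-- A spanning set contains a basis, indexed by `Fin n` when the dimension is `n`. -/
theorem exists_basis_fin_of_span_eq_top {K V : Type*} [Field K] [AddCommGroup V] [Module K V]
    [FiniteDimensional K V] {n : ℕ} (hn : finrank K V = n) {s : Set V}
    (hs : Submodule.span K s = ⊤) : ∃ b : Basis (Fin n) K V, ∀ i, b i ∈ s := by
  have := FiniteDimensional.fintypeBasisIndex (Basis.ofSpan hs.ge)
  let e := Fintype.equivFinOfCardEq ((finrank_eq_card_basis (Basis.ofSpan hs.ge)).symm.trans hn)
  refine ⟨(Basis.ofSpan hs.ge).reindex e, fun i ↦ ?_⟩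
  rw [Basis.reindex_apply]
  exact Basis.ofSpan_subset hs.ge (Set.mem_range_self _)

/-- If `e` intertwines `f` and `g`, it maps the span of the eigenvectors of `f` into that of `g`. -/
theorem Module.End.map_iSup_eigenspace_le {K V W : Type*} [Field K] [AddCommGroup V] [Module K V]
    [AddCommGroup W] [Module K W] {f : End K V} {g : End K W} (e : V →ₗ[K] W)
    (h : e ∘ₗ f = g ∘ₗ e) :
    (⨆ μ, f.eigenspace μ).map e ≤ ⨆ μ, g.eigenspace μ := by
  rw [Submodule.map_iSup]
  refine iSup_mono fun μ ↦ ?_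
  rintro _ ⟨v, hv, rfl⟩
  rw [SetLike.mem_coe, End.mem_eigenspace_iff] at hv
  rw [End.mem_eigenspace_iff, ← LinearMap.comp_apply, ← h, LinearMap.comp_apply, hv, map_smul]

/-- The span of the eigenvectors is an invariant subspace. -/
theorem Module.End.apply_mem_iSup_eigenspace {K V : Type*} [Field K] [AddCommGroup V] [Module K V]
    (f : End K V) {v : V} (hv : v ∈ ⨆ μ, f.eigenspace μ) : f v ∈ ⨆ μ, f.eigenspace μ :=
  End.map_iSup_eigenspace_le f rfl (Submodule.mem_map_of_mem hv)

/-- If the eigenvectors of `f` do not span, replacing `f` by the associated block diagonal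
endomorphism for a complement of their span produces strictly more eigenvectors. -/
theorem Module.End.iSup_eigenspace_lt_of_isCompl {K V : Type*} [Field K] [IsAlgClosed K]
    [AddCommGroup V] [Module K V] [FiniteDimensional K V] (f : End K V)
    (hf : (⨆ μ, f.eigenspace μ) ≠ ⊤) {W : Submodule K V} (hW : IsCompl (⨆ μ, f.eigenspace μ) W) :
    (⨆ μ, f.eigenspace μ) <
      ⨆ μ, End.eigenspace ((⨆ μ, f.eigenspace μ).projection W hW * f *
        (⨆ μ, f.eigenspace μ).projection W hW +
        W.projection _ hW.symm * f * W.projection _ hW.symm) μ := by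
  set U := ⨆ μ, f.eigenspace μ with hU
  set P := U.projection W hW
  set Q := W.projection U hW.symm
  have hle : U ≤ ⨆ μ, End.eigenspace (P * f * P + Q * f * Q) μ := by
    conv_lhs => rw [hU]
    refine iSup_mono fun μ v hv ↦ ?_
    have hvU : v ∈ U := le_iSup f.eigenspace μ hv
    rw [End.mem_eigenspace_iff] at hv ⊢
    have hP : P v = v := Submodule.projection_apply_of_mem_left hW hvU
    have hQ : Q v = 0 := (Submodule.projection_apply_eq_zero_iff hW.symm).2 hvU
    simp [hP, hQ, hv]
  refine lt_of_le_of_ne hle fun heq ↦ ?_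
  have hWbot : W ≠ ⊥ := fun h ↦ hf (by simpa [h] using hW.sup_eq_top)
  have : Nontrivial W := Submodule.nontrivial_iff_ne_bot.2 hWbot
  obtain ⟨μ, hμ⟩ := End.exists_eigenvalue
    ((W.projectionOnto U hW.symm ∘ₗ f ∘ₗ W.subtype : W →ₗ[K] W) : End K W)
  obtain ⟨w, hw⟩ := hμ.exists_hasEigenvector
  have hwe : Q (f w) = μ • (w : V) := by
    simpa using congrArg Subtype.val hw.apply_eq_smul
  have hP : P w = 0 := (Submodule.projection_apply_eq_zero_iff hW).2 w.2
  have hQ : Q w = w := Submodule.projection_apply_of_mem_left hW.symm w.2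
  have hmem : (w : V) ∈ U := by
    rw [hU, heq]
    refine le_iSup (End.eigenspace (P * f * P + Q * f * Q)) μ (End.mem_eigenspace_iff.2 ?_)
    simp [hP, hQ, hwe]
  exact hw.2 (Subtype.ext (Submodule.disjoint_def.1 hW.disjoint _ hmem w.2))

end Eigenspaces

section Diagonalizable

variable {n : ℕ} {A B : Matrix (Fin n) (Fin n) ℂ}

theorem isDiagonalizable_iff_exists_diagonal : IsDiagonalizable A ↔
    ∃ d : Fin n → ℂ, A ∈ conjClass (Matrix.diagonal d) := by
  constructor
  · rintro ⟨g, hg⟩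
    refine ⟨Matrix.diag (((g⁻¹ : (Matrix (Fin n) (Fin n) ℂ)ˣ) : Matrix (Fin n) (Fin n) ℂ) * A * g),
      g, ?_⟩
    rw [hg.diagonal_diag]
    simp [mul_assoc]
  · rintro ⟨d, g, rfl⟩
    refine ⟨g, ?_⟩
    simp [mul_assoc, Matrix.isDiag_diagonal]

theorem mem_conjClass_trans {C : Matrix (Fin n) (Fin n) ℂ} (hAB : A ∈ conjClass B)
    (hBC : B ∈ conjClass C) : A ∈ conjClass C := by
  obtain ⟨g, rfl⟩ := hAB
  obtain ⟨h, rfl⟩ := hBC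
  exact ⟨g * h, by simp [mul_assoc]⟩

theorem mem_conjClass_symm (hAB : A ∈ conjClass B) : B ∈ conjClass A := by
  obtain ⟨g, rfl⟩ := hAB
  exact ⟨g⁻¹, by simp [mul_assoc]⟩

theorem diagonal_comp_perm_mem_conjClass (d : Fin n → ℂ) (σ : Equiv.Perm (Fin n)) :
    Matrix.diagonal (d ∘ σ) ∈ conjClass (Matrix.diagonal d) := by
  refine ⟨⟨σ.permMatrix ℂ, σ⁻¹.permMatrix ℂ, ?_, ?_⟩, ?_⟩
  · simp [← Matrix.permMatrix_mul]
  · simp [← Matrix.permMatrix_mul]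
  · change _ = σ.permMatrix ℂ * _ * σ⁻¹.permMatrix ℂ
    rw [PEquiv.toMatrix_toPEquiv_mul, PEquiv.mul_toMatrix_toPEquiv, Matrix.submatrix_submatrix]
    exact (Matrix.submatrix_diagonal_equiv d σ).symm

/-- A matrix whose eigenvectors span is diagonalizable. -/
theorem isDiagonalizable_of_iSup_eigenspace_eq_top
    (h : (⨆ μ, End.eigenspace (Matrix.toLin' A) μ) = ⊤) : IsDiagonalizable A := by
  have hs : ⊤ ≤ Submodule.span ℂ {v | ∃ μ, v ∈ End.eigenspace (Matrix.toLin' A) μ} := by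
    rw [← h]
    exact iSup_le fun μ v hv ↦ Submodule.subset_span ⟨μ, hv⟩
  obtain ⟨b, hb⟩ := exists_basis_fin_of_span_eq_top (finrank_fin_fun ℂ) (top_le_iff.1 hs)
  replace hb (i : Fin n) : ∃ μ : ℂ, A.mulVec (b i) = μ • b i := by
    obtain ⟨μ, hμ⟩ := hb i
    exact ⟨μ, End.mem_eigenspace_iff.1 hμ⟩
  choose d hd using hb
  let G : Matrix (Fin n) (Fin n) ℂ := (Matrix.of b).transpose
  obtain ⟨g, hg⟩ : IsUnit G := Matrix.linearIndependent_cols_iff_isUnit.1 b.linearIndependent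
  have hcomm : A * G = G * Matrix.diagonal d := by
    ext i j
    rw [Matrix.mul_diagonal, mul_comm]
    exact congrFun (hd j) i
  refine isDiagonalizable_iff_exists_diagonal.2 ⟨d, g, ?_⟩
  rw [hg, ← hcomm, ← hg]
  simp [mul_assoc]

theorem charpoly_eq_of_mem_conjClass (h : A ∈ conjClass B) : A.charpoly = B.charpoly := by
  obtain ⟨g, rfl⟩ := h
  rw [Matrix.coe_units_inv, Matrix.charpoly_units_conj]

theorem aeval_eq_zero_of_mem_conjClass (h : A ∈ conjClass B) {p : ℂ[X]} (hp : aeval B p = 0) :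
    aeval A p = 0 := by
  obtain ⟨g, rfl⟩ := h
  have := Polynomial.aeval_algHom_apply
    (MulSemiringAction.toAlgHom ℂ (Matrix (Fin n) (Fin n) ℂ) (ConjAct.toConjAct g)) B p
  simpa [ConjAct.units_smul_def, hp] using this

/-- Diagonalizable matrices with the same characteristic polynomial are conjugate. -/
theorem mem_conjClass_of_charpoly_eq (hA : IsDiagonalizable A) (hB : IsDiagonalizable B)
    (h : A.charpoly = B.charpoly) : A ∈ conjClass B := by
  obtain ⟨d, hd⟩ := isDiagonalizable_iff_exists_diagonal.1 hA
  obtain ⟨d', hd'⟩ := isDiagonalizable_iff_exists_diagonal.1 hB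
  rw [charpoly_eq_of_mem_conjClass hd, charpoly_eq_of_mem_conjClass hd',
    Matrix.charpoly_diagonal, Matrix.charpoly_diagonal] at h
  have hroots (c : Fin n → ℂ) : (∏ i, (X - C (c i))).roots = Finset.univ.val.map c := by
    rw [← roots_multiset_prod_X_sub_C (Finset.univ.val.map c), Multiset.map_map]
    rfl
  obtain ⟨σ, rfl⟩ := exists_perm_comp_eq_of_map_univ_eq
    ((hroots d').symm.trans ((congrArg roots h.symm).trans (hroots d)))
  exact mem_conjClass_trans hd
    (mem_conjClass_trans (diagonal_comp_perm_mem_conjClass d' σ) (mem_conjClass_symm hd'))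

theorem exists_squarefree_aeval_eq_zero (hA : IsDiagonalizable A) :
    ∃ p : ℂ[X], Squarefree p ∧ aeval A p = 0 := by
  obtain ⟨d, hd⟩ := isDiagonalizable_iff_exists_diagonal.1 hA
  refine ⟨∏ c ∈ Finset.univ.image d, (X - C c), ?_, aeval_eq_zero_of_mem_conjClass hd ?_⟩
  · exact (separable_prod_X_sub_C_iff'.2 fun _ _ _ _ h ↦ h).squarefree
  · have := Polynomial.aeval_algHom_apply (Matrix.diagonalAlgHom ℂ) d
      (∏ c ∈ Finset.univ.image d, (X - C c))
    rw [Matrix.diagonalAlgHom_apply] at this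
    rw [this, Matrix.diagonalAlgHom_apply, Matrix.diagonal_eq_zero]
    ext i
    rw [← Pi.evalAlgHom_apply ℂ (fun _ ↦ ℂ) i (aeval d _), ← Polynomial.aeval_algHom_apply,
      map_prod]
    exact Finset.prod_eq_zero (Finset.mem_image_of_mem d (Finset.mem_univ i)) (by simp)

theorem isDiagonalizable_of_squarefree_aeval_eq_zero {p : ℂ[X]} (hp : Squarefree p)
    (hA : aeval A p = 0) : IsDiagonalizable A := by
  refine isDiagonalizable_of_iSup_eigenspace_eq_top
    (End.isSemisimple_of_squarefree_aeval_eq_zero hp ?_).iSup_eigenspace_eq_top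
  have := Polynomial.aeval_algHom_apply (Matrix.toLinAlgEquiv' (R := ℂ) (n := Fin n)).toAlgHom A p
  exact this.trans (by rw [hA, map_zero])

theorem isClosed_conjClass_of_isDiagonalizable (hA : IsDiagonalizable A) :
    IsClosed (conjClass A) := by
  obtain ⟨p, hp, hpA⟩ := exists_squarefree_aeval_eq_zero hA
  have : conjClass A = {B | aeval B p = 0} ∩ {B | B.charpoly = A.charpoly} := by
    ext B
    exact ⟨fun h ↦ ⟨aeval_eq_zero_of_mem_conjClass h hpA, charpoly_eq_of_mem_conjClass h⟩,
      fun h ↦ mem_conjClass_of_charpoly_eq (isDiagonalizable_of_squarefree_aeval_eq_zero hp h.1)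
        hA h.2⟩
  rw [this]
  exact (isClosed_singleton.preimage (Matrix.continuous_aeval p)).inter
    (Matrix.isClosed_setOf_charpoly_eq _)

/-- A closed conjugacy class contains the block diagonal part of each of its block triangular
members. -/
theorem block_diagonal_mem_conjClass (hA : IsClosed (conjClass A))
    {P Q : Matrix (Fin n) (Fin n) ℂ} (hP : P * P = P) (hQ : Q * Q = Q) (hPQ : P * Q = 0)
    (hQP : Q * P = 0) (hadd : P + Q = 1) (hQAP : Q * A * P = 0) :
    P * A * P + Q * A * Q ∈ conjClass A := by
  have hmem (t : ℂ) (ht : t ≠ 0) : P * A * P + Q * A * Q + t • (P * A * Q) ∈ conjClass A := by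
    refine ⟨⟨P + t⁻¹ • Q, P + t • Q, ?_, ?_⟩, ?_⟩
    · simp [mul_add, add_mul, hP, hQ, hPQ, hQP, smul_smul, ht, hadd]
    · simp [mul_add, add_mul, hP, hQ, hPQ, hQP, smul_smul, ht, hadd]
    · change _ = (P + t⁻¹ • Q) * A * (P + t • Q)
      simp only [mul_add, add_mul, smul_mul_assoc, mul_smul_comm, hQAP, smul_smul, smul_zero,
        smul_add, mul_inv_cancel₀ ht, one_smul, add_zero]
      abel
  have hcont : Continuous fun t : ℂ ↦ P * A * P + Q * A * Q + t • (P * A * Q) := by fun_prop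
  have hdense : Dense {t : ℂ | t ≠ 0} := dense_compl_singleton 0
  have := (hA.preimage hcont).closure_subset_iff.2 hmem (hdense 0)
  simpa using this

theorem isDiagonalizable_of_isClosed_conjClass (hA : IsClosed (conjClass A)) :
    IsDiagonalizable A := by
  refine isDiagonalizable_of_iSup_eigenspace_eq_top ?_
  by_contra hne
  set f : End ℂ (Fin n → ℂ) := Matrix.toLin' A
  obtain ⟨W, hW⟩ := Submodule.exists_isCompl (⨆ μ, f.eigenspace μ)
  have hlt := End.iSup_eigenspace_lt_of_isCompl f hne hW
  set U := ⨆ μ, f.eigenspace μ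
  set P := U.projection W hW
  set Q := W.projection U hW.symm
  let Φ := LinearMap.toMatrixAlgEquiv' (R := ℂ) (n := Fin n)
  have hΦf : Φ f = A := LinearMap.toMatrix'_toLin' A
  have hPU (v) : P v ∈ U := Submodule.projection_apply_mem hW v
  have hQW (v) : Q v ∈ W := Submodule.projection_apply_mem hW.symm v
  have hQU {v} (hv : v ∈ U) : Q v = 0 := (Submodule.projection_apply_eq_zero_iff hW.symm).2 hv
  have hPW {v} (hv : v ∈ W) : P v = 0 := (Submodule.projection_apply_eq_zero_iff hW).2 hv
  have hmem : Φ (P * f * P + Q * f * Q) ∈ conjClass A := by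
    have := block_diagonal_mem_conjClass (P := Φ P) (Q := Φ Q) hA
      (by rw [← map_mul, (Submodule.isIdempotentElem_projection hW).eq])
      (by rw [← map_mul, (Submodule.isIdempotentElem_projection hW.symm).eq])
      (by rw [← map_mul, show P * Q = 0 from LinearMap.ext fun v ↦ hPW (hQW v), map_zero])
      (by rw [← map_mul, show Q * P = 0 from LinearMap.ext fun v ↦ hQU (hPU v), map_zero])
      (by
        rw [← map_add, ← map_one Φ]
        exact congrArg Φ (Submodule.projection_add_projection_eq_id hW))
      (by
        rw [← hΦf, ← map_mul, ← map_mul, show Q * f * P = 0 from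
          LinearMap.ext fun v ↦ hQU (f.apply_mem_iSup_eigenspace (hPU v)), map_zero])
    simpa [hΦf] using this
  obtain ⟨g, hg⟩ := mem_conjClass_symm hmem
  have hgf : f = Φ.symm g * (P * f * P + Q * f * Q) * Φ.symm ↑g⁻¹ := by
    apply Φ.injective
    rw [map_mul, map_mul, Φ.apply_symm_apply, Φ.apply_symm_apply, ← hg, hΦf]
  have hinv : Φ.symm ↑g⁻¹ * Φ.symm g = 1 := by rw [← map_mul, Units.inv_mul, map_one]
  have hle := End.map_iSup_eigenspace_le (f := P * f * P + Q * f * Q) (g := f) (Φ.symm g) (by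
    change Φ.symm g * _ = f * Φ.symm g
    conv_rhs => rw [hgf, mul_assoc, hinv, mul_one])
  have hinj : Function.Injective (Φ.symm g) :=
    Function.LeftInverse.injective (g := Φ.symm ↑g⁻¹) fun v ↦ LinearMap.congr_fun hinv v
  have h₁ := Submodule.finrank_mono hle
  rw [← (Submodule.equivMapOfInjective _ hinj _).finrank_eq] at h₁
  exact (Submodule.finrank_lt_finrank_of_lt hlt).not_ge h₁

end Diagonalizable

/-- The `GL_n(ℂ)`-conjugacy class of `A ∈ Mat_n(ℂ)` is closed in `Mat_n(ℂ)`
if and only if `A` is diagonalizable. -/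
theorem conjClass_isClosed_iff_isDiagonalizable {n : ℕ} (A : Matrix (Fin n) (Fin n) ℂ) :
    IsClosed (conjClass A) ↔ IsDiagonalizable A :=
  ⟨isDiagonalizable_of_isClosed_conjClass, isClosed_conjClass_of_isDiagonalizable⟩
end

section
/- Let L be a finite-dimensional semisimple Lie algebra over ℂ with Cartan subalgebra H, simple roots Π, and let h ∈ H be the unique element with α(h) = 2 for all α ∈ Π. For each α ∈ Π choose e_α ∈ g_α and e_{−α} ∈ g_{−α} with [e_α, e_{−α}] = h_α (the coroot of α), and let c_α ∈ ℂ be the unique coefficients with h = Σ_{α∈Π} c_α·h_α. Then the elements ξ := Σ_{α∈Π} e_α and η := Σ_{α∈Π} c_α·e_{−α} satisfy [ξ, η] = h, [h, ξ] = 2·ξ, and [h, η] = −2·η; that is, (ξ, h, η) is an sl₂(ℂ)-triple. -/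
/-- The root space `g_α = {x ∈ L : ⁅t, x⁆ = α(t) • x for all t ∈ H}` associated to a linear
functional `α` on a Lie subalgebra `H` of `L`. -/
def rootSpaceOf {L : Type*} [LieRing L] [LieAlgebra ℂ L] (H : LieSubalgebra ℂ L)
    (α : Module.Dual ℂ H) : Submodule ℂ L where
  carrier := {x | ∀ t : H, ⁅(t : L), x⁆ = α t • x}
  add_mem' := by
    intro a b ha hb t
    simp only [Set.mem_setOf_eq] at *
    rw [lie_add, ha t, hb t, smul_add]
  zero_mem' := by
    intro t
    simp
  smul_mem' := by
    intro c x hx t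
    simp only [Set.mem_setOf_eq] at *
    rw [lie_smul, hx t, smul_comm]

theorem lie_mem_rootSpaceOf_add {L : Type*} [LieRing L] [LieAlgebra ℂ L] {H : LieSubalgebra ℂ L}
    {α β : Module.Dual ℂ H} {x y : L} (hx : x ∈ rootSpaceOf H α) (hy : y ∈ rootSpaceOf H β) :
    ⁅x, y⁆ ∈ rootSpaceOf H (α + β) := by
  intro t
  rw [leibniz_lie, hx t, hy t, smul_lie, lie_smul, LinearMap.add_apply, add_smul]

/-- A nonzero combination of vectors in `S` with integer coefficients of constant sign does not
vanish at a point where all elements of `S` take the value `2`. -/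
theorem eq_zero_of_apply_eq_zero_of_sum_zsmul {V : Type*} [AddCommGroup V] [Module ℂ V]
    {S : Finset (Module.Dual ℂ V)} {h : V} (hh : ∀ α ∈ S, α h = 2)
    {β : Module.Dual ℂ V} {c : Module.Dual ℂ V → ℤ} (hβ : β = ∑ α ∈ S, c α • α)
    (hc : (∀ α ∈ S, 0 ≤ c α) ∨ (∀ α ∈ S, c α ≤ 0)) (hβh : β h = 0) : β = 0 := by
  have hsum : ∑ α ∈ S, c α = 0 := by
    have key : β h = ((∑ α ∈ S, c α : ℤ) : ℂ) * 2 := by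
      rw [hβ, LinearMap.sum_apply, Int.cast_sum, Finset.sum_mul]
      refine Finset.sum_congr rfl fun α hα ↦ ?_
      rw [LinearMap.smul_apply, hh α hα, zsmul_eq_mul]
    rw [hβh] at key
    exact_mod_cast (mul_eq_zero.mp key.symm).resolve_right two_ne_zero
  have hzero : ∀ α ∈ S, c α = 0 := by
    rcases hc with hc | hc
    · exact (Finset.sum_eq_zero_iff_of_nonneg hc).mp hsum
    · exact (Finset.sum_eq_zero_iff_of_nonpos hc).mp hsum
  rw [hβ]
  exact Finset.sum_eq_zero fun α hα ↦ by rw [hzero α hα, zero_smul]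

/-- **Kostant's `sl₂`-triple.** Let `L` be a finite-dimensional complex
semisimple Lie algebra with Cartan subalgebra `H` and simple roots `Δs ⊆ Δ`, and let `h ∈ H`
be the element with `α h = 2` for all `α ∈ Δs`.  For each simple `α` choose `e α ∈ g_α` and
`f α ∈ g_{-α}` whose bracket is the coroot `hcor α ∈ H`, and let `c α` be the coefficients
with `h = Σ_{α ∈ Δs} c α • hcor α`.  Then `ξ := Σ e α` and `η := Σ c α • f α` satisfy
`⁅ξ, η⁆ = h`, `⁅h, ξ⁆ = 2 • ξ` and `⁅h, η⁆ = (-2) • η`; that is, `(ξ, h, η)` is an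
`sl₂(ℂ)`-triple. -/
theorem kostant_sl2_triple
    (L : Type*) [LieRing L] [LieAlgebra ℂ L] [FiniteDimensional ℂ L]
    [LieAlgebra.IsSemisimple ℂ L]
    (H : LieSubalgebra ℂ L) [H.IsCartanSubalgebra]
    -- `Δ` is the set of roots of `L` with respect to `H`:
    (Δ : Finset (Module.Dual ℂ H))
    (hΔ : ∀ α : Module.Dual ℂ H, α ∈ Δ ↔ α ≠ 0 ∧ rootSpaceOf H α ≠ ⊥)
    -- `Δs` is a base of simple roots:
    (Δs : Finset (Module.Dual ℂ H)) (hΔs : Δs ⊆ Δ)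
    (hbase : ∀ β ∈ Δ, ∃ c : Module.Dual ℂ H → ℤ,
      (β : Module.Dual ℂ H) = ∑ α ∈ Δs, c α • α ∧
        ((∀ α ∈ Δs, 0 ≤ c α) ∨ (∀ α ∈ Δs, c α ≤ 0)))
    -- choices of root vectors `e α ∈ g_α`, `f α ∈ g_{-α}` with `⁅e α, f α⁆ = hcor α`,
    -- the coroot of `α`:
    (e f : Module.Dual ℂ H → L) (hcor : Module.Dual ℂ H → H)
    (he : ∀ α ∈ Δs, e α ∈ rootSpaceOf H α)
    (hf : ∀ α ∈ Δs, f α ∈ rootSpaceOf H (-α))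
    (hef : ∀ α ∈ Δs, ⁅e α, f α⁆ = (hcor α : L))
    -- `h` is the element of `H` with `α h = 2` for all simple `α`, written in the basis of
    -- simple coroots with coefficients `c`:
    (h : H) (hh : ∀ α ∈ Δs, α h = 2)
    (c : Module.Dual ℂ H → ℂ) (hc : h = ∑ α ∈ Δs, c α • hcor α) :
    ⁅∑ α ∈ Δs, e α, ∑ α ∈ Δs, c α • f α⁆ = (h : L) ∧
      ⁅(h : L), ∑ α ∈ Δs, e α⁆ = (2 : ℂ) • ∑ α ∈ Δs, e α ∧
      ⁅(h : L), ∑ α ∈ Δs, c α • f α⁆ = (-2 : ℂ) • ∑ α ∈ Δs, c α • f α := by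
  have hlie : ∀ α ∈ Δs, ∀ β ∈ Δs, α ≠ β → ⁅e α, f β⁆ = 0 := by
    intro α hα β hβ hne
    by_contra hbr
    have hmem := lie_mem_rootSpaceOf_add (he α hα) (hf β hβ)
    have hne' : α + -β ≠ 0 := by rwa [← sub_eq_add_neg, sub_ne_zero]
    obtain ⟨d, hd, hsign⟩ := hbase (α + -β)
      ((hΔ _).mpr ⟨hne', (Submodule.ne_bot_iff _).mpr ⟨_, hmem, hbr⟩⟩)
    refine hne' (eq_zero_of_apply_eq_zero_of_sum_zsmul hh hd hsign ?_)
    rw [LinearMap.add_apply, LinearMap.neg_apply, hh α hα, hh β hβ, add_neg_cancel]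
  refine ⟨?_, ?_, ?_⟩
  · have hcoe : (h : L) = ∑ α ∈ Δs, c α • (hcor α : L) := by
      simpa using congrArg H.subtype hc
    rw [sum_lie, hcoe]
    refine Finset.sum_congr rfl fun α hα ↦ ?_
    rw [lie_sum, Finset.sum_eq_single_of_mem α hα, lie_smul, hef α hα]
    intro β hβ hne
    rw [lie_smul, hlie α hα β hβ hne.symm, smul_zero]
  · rw [lie_sum, Finset.smul_sum]
    refine Finset.sum_congr rfl fun α hα ↦ ?_
    rw [he α hα h, hh α hα]
  · rw [lie_sum, Finset.smul_sum]
    refine Finset.sum_congr rfl fun α hα ↦ ?_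
    rw [lie_smul, hf α hα h, LinearMap.neg_apply, hh α hα, smul_comm]
end

section
/- Let L be a finite-dimensional semisimple Lie algebra over ℂ with Cartan subalgebra H, roots Δ, and simple roots Π. Suppose h ∈ H satisfies: for every α ∈ Π, Re(α(h)) ≥ 0, and whenever Re(α(h)) = 0 one has Im(α(h)) ≥ 0. Then: (a) the centralizer {y ∈ L : [h, y] = 0} equals H ⊕ ⊕_{α ∈ Δ, α(h) = 0} g_α; and (b) a root β ∈ Δ satisfies β(h) = 0 if and only if β is a ℤ-linear combination of elements of {α ∈ Π : α(h) = 0}. -/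
/-- If `f` vanishes on `A` and `B` is spanned by eigenspaces of `f` for nonzero eigenvalues, and
`A` and `B` span the whole space, then `A` is the kernel of `f`. -/
theorem LinearMap.ker_eq_of_sup_eq_top_of_le_iSup_eigenspace {K V : Type*} [Field K]
    [AddCommGroup V] [Module K V] (f : Module.End K V) {A B : Submodule K V}
    (hA : A ≤ LinearMap.ker f) (hB : B ≤ ⨆ μ : K, ⨆ _ : μ ≠ 0, f.eigenspace μ)
    (hAB : A ⊔ B = ⊤) : LinearMap.ker f = A := by
  have hdisj : B ⊓ LinearMap.ker f = ⊥ := by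
    rw [← disjoint_iff, ← Module.End.eigenspace_zero]
    exact ((f.eigenspaces_iSupIndep 0).symm).mono_left hB
  rw [← top_inf_eq (LinearMap.ker f), ← hAB, sup_inf_assoc_of_le B hA, hdisj, sup_bot_eq]

/-- If a combination with nonnegative integer coefficients of complex numbers, each nonnegative in
the lexicographic order on `(re, im)`, vanishes, then all its terms vanish. -/
theorem Complex.eq_zero_of_sum_intCast_mul_eq_zero {ι : Type*} {s : Finset ι} {c : ι → ℤ}
    {z : ι → ℂ} (hz : ∀ i ∈ s, 0 ≤ (z i).re ∧ ((z i).re = 0 → 0 ≤ (z i).im))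
    (hc : ∀ i ∈ s, 0 ≤ c i) (hsum : ∑ i ∈ s, (c i : ℂ) * z i = 0) {i : ι} (hi : i ∈ s)
    (hzi : z i ≠ 0) : c i = 0 := by
  have hre : ∀ j ∈ s, (c j : ℝ) * (z j).re = 0 := by
    rw [← Finset.sum_eq_zero_iff_of_nonneg fun j hj ↦
      mul_nonneg (Int.cast_nonneg (hc j hj)) (hz j hj).1]
    simpa using congrArg Complex.re hsum
  have him : ∀ j ∈ s, (c j : ℝ) * (z j).im = 0 := by
    rw [← Finset.sum_eq_zero_iff_of_nonneg]
    · simpa using congrArg Complex.im hsum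
    · intro j hj
      rcases mul_eq_zero.mp (hre j hj) with h | h
      · simp [h]
      · exact mul_nonneg (Int.cast_nonneg (hc j hj)) ((hz j hj).2 h)
  by_contra hci
  have hci' : (c i : ℝ) ≠ 0 := Int.cast_ne_zero.mpr hci
  exact hzi (Complex.ext (by simpa [hci'] using hre i hi) (by simpa [hci'] using him i hi))

/-- Let `L` be a finite-dimensional complex semisimple Lie algebra with
Cartan subalgebra `H`, set of roots `Δ` and simple roots `Δs`.  Suppose `h ∈ H` satisfies
`Re (α h) ≥ 0` for all simple `α`, and `Im (α h) ≥ 0` whenever `Re (α h) = 0`.  Then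
(a) the centralizer of `h` equals `H ⊕ ⊕_{α ∈ Δ, α h = 0} g_α`, and
(b) a root `β` vanishes on `h` iff `β` is a `ℤ`-linear combination of the simple roots
vanishing on `h`. -/
theorem centralizer_of_dominant_semisimple_element
    (L : Type*) [LieRing L] [LieAlgebra ℂ L] [FiniteDimensional ℂ L]
    [LieAlgebra.IsSemisimple ℂ L]
    (H : LieSubalgebra ℂ L) [H.IsCartanSubalgebra]
    -- `Δ` is the set of roots of `L` with respect to `H`:
    (Δ : Finset (Module.Dual ℂ H))
    (hΔ : ∀ α : Module.Dual ℂ H, α ∈ Δ ↔ α ≠ 0 ∧ rootSpaceOf H α ≠ ⊥)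
    -- root space decomposition of `L`:
    (hsup : H.toSubmodule ⊔ (⨆ α ∈ Δ, rootSpaceOf H α) = ⊤)
    (hindep : iSupIndep (fun o : Option {α // α ∈ Δ} =>
      o.elim H.toSubmodule fun α => rootSpaceOf H (α : Module.Dual ℂ H)))
    -- `Δs` is a base of simple roots:
    (Δs : Finset (Module.Dual ℂ H)) (hΔs : Δs ⊆ Δ)
    (hbase : ∀ β ∈ Δ, ∃ c : Module.Dual ℂ H → ℤ,
      (β : Module.Dual ℂ H) = ∑ α ∈ Δs, c α • α ∧
        ((∀ α ∈ Δs, 0 ≤ c α) ∨ (∀ α ∈ Δs, c α ≤ 0)))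
    -- the element `h` lies in the fundamental domain `D`:
    (h : H)
    (hdom : ∀ α ∈ Δs, 0 ≤ (α h).re ∧ ((α h).re = 0 → 0 ≤ (α h).im)) :
    LinearMap.ker (LieAlgebra.ad ℂ L (h : L)) =
        H.toSubmodule ⊔ (⨆ α ∈ Δ, ⨆ _ : α h = 0, rootSpaceOf H α) ∧
      ∀ β ∈ Δ, (β h = 0 ↔ ∃ c : Module.Dual ℂ H → ℤ,
        (∀ α ∈ Δs, α h ≠ 0 → c α = 0) ∧ (β : Module.Dual ℂ H) = ∑ α ∈ Δs, c α • α) := by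
  have heigen (α : Module.Dual ℂ H) :
      rootSpaceOf H α ≤ (LieAlgebra.ad ℂ L (h : L)).eigenspace (α h) := fun x hx ↦ by
    simpa [Module.End.mem_eigenspace_iff] using hx h
  have hH : H.toSubmodule ≤ LinearMap.ker (LieAlgebra.ad ℂ L (h : L)) := fun x hx ↦ by
    simpa using congrArg Subtype.val (trivial_lie_zero H H h ⟨x, hx⟩)
  refine ⟨?_, fun β hβ ↦ ⟨fun hβh ↦ ?_, ?_⟩⟩
  · refine LinearMap.ker_eq_of_sup_eq_top_of_le_iSup_eigenspace _
      (B := ⨆ α ∈ Δ, ⨆ _ : α h ≠ 0, rootSpaceOf H α) ?_ ?_ ?_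
    · refine sup_le hH (iSup₂_le fun α _ ↦ iSup_le fun hα ↦ ?_)
      simpa [hα] using heigen α
    · exact iSup₂_le fun α _ ↦ iSup_le fun hα ↦ (heigen α).trans (le_iSup₂_of_le (α h) hα le_rfl)
    · rw [eq_top_iff, ← hsup, sup_assoc]
      refine sup_le_sup_left (iSup₂_le fun α hα ↦ ?_) _
      by_cases hαh : α h = 0
      · exact le_sup_of_le_left (le_iSup₂_of_le α hα (le_iSup_of_le hαh le_rfl))
      · exact le_sup_of_le_right (le_iSup₂_of_le α hα (le_iSup_of_le hαh le_rfl))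
  · obtain ⟨c, rfl, hc⟩ := hbase β hβ
    have hsum : ∑ α ∈ Δs, (c α : ℂ) * α h = 0 := by simpa using hβh
    refine ⟨c, fun α hα hαh ↦ ?_, rfl⟩
    rcases hc with hc | hc
    · exact Complex.eq_zero_of_sum_intCast_mul_eq_zero hdom hc hsum hα hαh
    · refine neg_eq_zero.mp (Complex.eq_zero_of_sum_intCast_mul_eq_zero (c := fun α ↦ -c α) hdom
        (fun α hα ↦ neg_nonneg.mpr (hc α hα)) ?_ hα hαh)
      simpa using hsum
  · rintro ⟨c, hc, rfl⟩
    suffices ∑ α ∈ Δs, (c α : ℂ) * α h = 0 by simpa using this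
    refine Finset.sum_eq_zero fun α hα ↦ ?_
    by_cases hαh : α h = 0
    · simp [hαh]
    · simp [hc α hα hαh]
end

section
/- Let L be a finite-dimensional semisimple Lie algebra over ℂ with Cartan subalgebra H and simple roots Π, and let h ∈ H be the unique element with α(h) = 2 for all α ∈ Π. Then the centralizer {y ∈ L : [h, y] = 0} equals H; in particular its dimension equals dim H, the rank of L. -/
/-- A nonzero integral combination, with coefficients all of the same sign, of functionals taking
the value `2` at `h` does not vanish at `h`. -/
theorem apply_ne_zero_of_eq_sum_zsmul {V : Type*} [AddCommGroup V] [Module ℂ V]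
    {s : Finset (Module.Dual ℂ V)} {h : V} (hs : ∀ α ∈ s, α h = 2) {β : Module.Dual ℂ V}
    (hβ : β ≠ 0) {c : Module.Dual ℂ V → ℤ} (hsum : β = ∑ α ∈ s, c α • α)
    (hc : (∀ α ∈ s, 0 ≤ c α) ∨ (∀ α ∈ s, c α ≤ 0)) : β h ≠ 0 := by
  intro h0
  have hval : β h = ((∑ α ∈ s, c α : ℤ) : ℂ) * 2 := by
    rw [hsum, LinearMap.sum_apply, Int.cast_sum, Finset.sum_mul]
    refine Finset.sum_congr rfl fun α hα => ?_
    rw [LinearMap.smul_apply, hs α hα, zsmul_eq_mul]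
  have hzero : ∑ α ∈ s, c α = 0 := by
    rw [h0] at hval
    exact_mod_cast (mul_eq_zero.mp hval.symm).resolve_right two_ne_zero
  have hall : ∀ α ∈ s, c α = 0 := by
    rcases hc with hc | hc
    · exact (Finset.sum_eq_zero_iff_of_nonneg hc).mp hzero
    · exact (Finset.sum_eq_zero_iff_of_nonpos hc).mp hzero
  exact hβ (hsum.trans (Finset.sum_eq_zero fun α hα => by rw [hall α hα, zero_smul]))

/-- Let `L` be a finite-dimensional complex semisimple Lie algebra with
Cartan subalgebra `H`, roots `Δ` and simple roots `Δs`, and let `h ∈ H` be the element with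
`α h = 2` for every simple root `α`.  Then the centralizer of `h` in `L` equals `H`; in
particular its dimension equals `dim H`, the rank of `L`. -/
theorem centralizer_of_regular_dominant_element
    (L : Type*) [LieRing L] [LieAlgebra ℂ L] [FiniteDimensional ℂ L]
    [LieAlgebra.IsSemisimple ℂ L]
    (H : LieSubalgebra ℂ L) [H.IsCartanSubalgebra]
    -- `Δ` is the set of roots of `L` with respect to `H`:
    (Δ : Finset (Module.Dual ℂ H))
    (hΔ : ∀ α : Module.Dual ℂ H, α ∈ Δ ↔ α ≠ 0 ∧ rootSpaceOf H α ≠ ⊥)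
    -- root space decomposition of `L`:
    (hsup : H.toSubmodule ⊔ (⨆ α ∈ Δ, rootSpaceOf H α) = ⊤)
    (hindep : iSupIndep (fun o : Option {α // α ∈ Δ} =>
      o.elim H.toSubmodule fun α => rootSpaceOf H (α : Module.Dual ℂ H)))
    -- `Δs` is a base of simple roots:
    (Δs : Finset (Module.Dual ℂ H)) (hΔs : Δs ⊆ Δ)
    (hbase : ∀ β ∈ Δ, ∃ c : Module.Dual ℂ H → ℤ,
      (β : Module.Dual ℂ H) = ∑ α ∈ Δs, c α • α ∧
        ((∀ α ∈ Δs, 0 ≤ c α) ∨ (∀ α ∈ Δs, c α ≤ 0)))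
    -- `h` takes the value `2` on every simple root:
    (h : H) (hh : ∀ α ∈ Δs, α h = 2) :
    LinearMap.ker (LieAlgebra.ad ℂ L (h : L)) = H.toSubmodule ∧
      Module.finrank ℂ (LinearMap.ker (LieAlgebra.ad ℂ L (h : L))) = Module.finrank ℂ H := by
  have hker : LinearMap.ker (LieAlgebra.ad ℂ L (h : L)) = H.toSubmodule := by
    have hle : H.toSubmodule ≤ LinearMap.ker (LieAlgebra.ad ℂ L (h : L)) := by
      intro t ht
      have : ⁅h, (⟨t, ht⟩ : H)⁆ = 0 := trivial_lie_zero _ _ _ _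
      simpa using congrArg (Subtype.val) this
    refine le_antisymm (fun y hy => ?_) hle
    obtain ⟨t, ht, s, hs, rfl⟩ := Submodule.mem_sup.mp (hsup ▸ Submodule.mem_top (x := y))
    have hs_ker : s ∈ LinearMap.ker (LieAlgebra.ad ℂ L (h : L)) := by
      simpa using sub_mem hy (hle ht)
    have hroots : (⨆ α ∈ Δ, rootSpaceOf H α) ≤
        ⨆ μ ≠ (0 : ℂ), (LieAlgebra.ad ℂ L (h : L)).eigenspace μ := by
      refine iSup₂_le fun β hβ => ?_
      obtain ⟨c, hsum, hc⟩ := hbase β hβ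
      have hne : β h ≠ 0 :=
        apply_ne_zero_of_eq_sum_zsmul hh ((hΔ β).mp hβ).1 hsum hc
      refine le_trans (fun x hx => ?_) (le_iSup₂ (β h) hne)
      exact Module.End.mem_eigenspace_iff.mpr (hx h)
    have hs_zero : s = 0 :=
      Submodule.disjoint_def.mp
        ((LieAlgebra.ad ℂ L (h : L)).eigenspaces_iSupIndep 0) s
        (by rwa [Module.End.eigenspace_zero]) (hroots hs)
    rwa [hs_zero, add_zero]
  exact ⟨hker, by rw [hker]; rfl⟩
end
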